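/- arXiv:2211.00697 — 3 statements merged into one kernel-verified Lean document; each statement's English description precedes it below -/
import Mathlib

section
/- Let G be a positive natural number, let c be a real number with 0 ≤ c < 1/2, and let ε₁, …, ε_G be nonnegative real numbers with ∑_{i=1}^G εᵢ ≤ c. Then ∑_{i=1}^G 1/(1 - 2εᵢ) ≤ (G - 1) + 1/(1 - 2c). -/
/-- The chord bound for the convex function `x ↦ 1 / (1 - 2 * x)` on `[0, c]`. -/
lemma one_div_one_sub_two_mul_le_chord {x c : ℝ} (hx : 0 ≤ x) (hxc : x ≤ c) (hc : c < 1 / 2) :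
    1 / (1 - 2 * x) ≤ 1 + 2 / (1 - 2 * c) * x := by
  have hc' : 0 < 1 - 2 * c := by linarith
  have hx' : 0 < 1 - 2 * x := by linarith
  calc 1 / (1 - 2 * x) = 1 + 2 / (1 - 2 * x) * x := by field_simp; ring
    _ ≤ 1 + 2 / (1 - 2 * c) * x := by gcongr

/-- Solution of the convex maximization problem P1: if `0 ≤ c < 1/2` and
`ε₁,…,ε_G ≥ 0` with `∑ εᵢ ≤ c`, then `∑ 1/(1-2εᵢ) ≤ (G-1) + 1/(1-2c)`. -/
theorem sum_inv_one_sub_two_mul_le (G : ℕ) (hG : 0 < G) (c : ℝ) (hc0 : 0 ≤ c)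
    (hc : c < 1 / 2) (ε : Fin G → ℝ) (hε : ∀ i, 0 ≤ ε i) (hsum : ∑ i, ε i ≤ c) :
    ∑ i, 1 / (1 - 2 * ε i) ≤ ((G : ℝ) - 1) + 1 / (1 - 2 * c) := by
  have hc' : 0 < 1 - 2 * c := by linarith
  have hle (i : Fin G) : ε i ≤ c :=
    (Finset.single_le_sum (fun j _ => hε j) (Finset.mem_univ i)).trans hsum
  calc ∑ i, 1 / (1 - 2 * ε i)
      ≤ ∑ i, (1 + 2 / (1 - 2 * c) * ε i) :=
        Finset.sum_le_sum fun i _ => one_div_one_sub_two_mul_le_chord (hε i) (hle i) hc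
    _ = G + 2 / (1 - 2 * c) * ∑ i, ε i := by simp [Finset.sum_add_distrib, Finset.mul_sum]
    _ ≤ G + 2 / (1 - 2 * c) * c := by gcongr
    _ = ((G : ℝ) - 1) + 1 / (1 - 2 * c) := by field_simp; ring
end

section
/- Let G be a positive natural number, let I ≥ 0 and let c be a real number with 0 < c < 1/2. Then for all real numbers ε₁, …, ε_G with εᵢ ≥ 0 and ∑_{i=1}^G εᵢ ≤ c, one has ∑_{i=1}^G (I + h₂(εᵢ))/(1 - 2εᵢ) ≤ (G - 1)·I + (I + G·h₂(c/G))/(1 - 2c). -/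
/-- The binary entropy function `h₂(x) = -x·log₂ x - (1-x)·log₂(1-x)`,
with the convention `0·log₂ 0 = 0` (automatic since `Real.logb 2 0 = 0`). -/
noncomputable def binEnt (x : ℝ) : ℝ :=
  -x * Real.logb 2 x - (1 - x) * Real.logb 2 (1 - x)

theorem binEnt_eq (x : ℝ) : binEnt x = Real.binEntropy x / Real.log 2 := by
  rw [binEnt, Real.binEntropy, Real.logb, Real.logb, Real.log_inv, Real.log_inv]
  ring

theorem binEnt_nonneg {x : ℝ} (h0 : 0 ≤ x) (h1 : x ≤ 1) : 0 ≤ binEnt x := by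
  rw [binEnt_eq]
  exact div_nonneg (Real.binEntropy_nonneg h0 h1) (Real.log_nonneg one_le_two)

theorem concaveOn_binEnt : ConcaveOn ℝ (Set.Icc 0 1) binEnt := by
  have h := Real.strictConcave_binEntropy.concaveOn.smul
    (inv_nonneg.2 (Real.log_nonneg one_le_two))
  refine h.congr fun x _ => ?_
  simp only [binEnt_eq, smul_eq_mul]
  ring

theorem monotoneOn_binEnt : MonotoneOn binEnt (Set.Icc 0 2⁻¹) := fun x hx y hy hxy => by
  rw [binEnt_eq, binEnt_eq]
  exact div_le_div_of_nonneg_right (Real.binEntropy_strictMonoOn.monotoneOn hx hy hxy)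
    (Real.log_nonneg one_le_two)

/-- Jensen's inequality for the binary entropy under a bound `c ≤ 1/2` on the total mass. -/
theorem sum_binEnt_le {G : ℕ} (hG : 0 < G) {c : ℝ} (hc : c ≤ 1 / 2) {ε : Fin G → ℝ}
    (hε : ∀ i, 0 ≤ ε i) (hsum : ∑ i, ε i ≤ c) :
    ∑ i, binEnt (ε i) ≤ G * binEnt (c / G) := by
  have hG' : (0 : ℝ) < G := Nat.cast_pos.2 hG
  have hG1 : (1 : ℝ) ≤ G := Nat.one_le_cast.2 hG
  have hle (i : Fin G) : ε i ≤ c :=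
    (Finset.single_le_sum (fun j _ => hε j) (Finset.mem_univ i)).trans hsum
  have hS : 0 ≤ ∑ i, ε i := Finset.sum_nonneg fun i _ => hε i
  have hJ := concaveOn_binEnt.le_map_sum (t := Finset.univ) (w := fun _ : Fin G => (G : ℝ)⁻¹)
    (p := ε) (fun _ _ => inv_nonneg.2 hG'.le) (by simp [hG'.ne'])
    (fun i _ => ⟨hε i, by linarith [hle i]⟩)
  simp only [smul_eq_mul, ← Finset.mul_sum] at hJ
  have hmono : (G : ℝ)⁻¹ * ∑ i, ε i ≤ c / G := by
    rw [inv_mul_eq_div]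
    gcongr
  have hcG : c / G ≤ 2⁻¹ := by
    rw [div_le_iff₀ hG']
    linarith
  have h0 : 0 ≤ (G : ℝ)⁻¹ * ∑ i, ε i := by positivity
  have := hJ.trans (monotoneOn_binEnt ⟨h0, hmono.trans hcG⟩ ⟨h0.trans hmono, hcG⟩ hmono)
  rwa [inv_mul_le_iff₀ hG'] at this

/-- Combination of the optima of P1 and P3: if `I ≥ 0`, `0 < c < 1/2`, and
`ε₁,…,ε_G ≥ 0` with `∑ εᵢ ≤ c`, then
`∑ (I + h₂(εᵢ))/(1-2εᵢ) ≤ (G-1)·I + (I + G·h₂(c/G))/(1-2c)`. -/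
theorem sum_combined_le (G : ℕ) (hG : 0 < G) (I : ℝ) (hI : 0 ≤ I)
    (c : ℝ) (hc0 : 0 < c) (hc : c < 1 / 2)
    (ε : Fin G → ℝ) (hε : ∀ i, 0 ≤ ε i) (hsum : ∑ i, ε i ≤ c) :
    ∑ i, (I + binEnt (ε i)) / (1 - 2 * ε i)
      ≤ ((G : ℝ) - 1) * I + (I + (G : ℝ) * binEnt (c / G)) / (1 - 2 * c) := by
  have hd : 0 < 1 - 2 * c := by linarith
  have hterm (i : Fin G) : (I + binEnt (ε i)) / (1 - 2 * ε i) ≤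
      I + I * (2 / (1 - 2 * c)) * ε i + binEnt (ε i) / (1 - 2 * c) := by
    have hle : ε i ≤ c :=
      (Finset.single_le_sum (fun j _ => hε j) (Finset.mem_univ i)).trans hsum
    have hdi : 0 < 1 - 2 * ε i := by linarith
    have hI' : I / (1 - 2 * ε i) ≤ I + I * (2 / (1 - 2 * c)) * ε i := by
      calc I / (1 - 2 * ε i) = I + I * (2 / (1 - 2 * ε i)) * ε i := by
            field_simp
            ring
        _ ≤ _ := by
            have := hε i
            gcongr
    have hh : binEnt (ε i) / (1 - 2 * ε i) ≤ binEnt (ε i) / (1 - 2 * c) :=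
      div_le_div_of_nonneg_left (binEnt_nonneg (hε i) (by linarith)) hd (by linarith)
    rw [add_div]
    exact add_le_add hI' hh
  calc ∑ i, (I + binEnt (ε i)) / (1 - 2 * ε i)
      ≤ ∑ i, (I + I * (2 / (1 - 2 * c)) * ε i + binEnt (ε i) / (1 - 2 * c)) :=
        Finset.sum_le_sum fun i _ => hterm i
    _ = G * I + I * (2 / (1 - 2 * c)) * ∑ i, ε i + (∑ i, binEnt (ε i)) / (1 - 2 * c) := by
        simp [Finset.sum_add_distrib, Finset.mul_sum, Finset.sum_div]
    _ ≤ G * I + I * (2 / (1 - 2 * c)) * c + G * binEnt (c / G) / (1 - 2 * c) := by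
        gcongr
        exact sum_binEnt_le hG hc.le hε hsum
    _ = ((G : ℝ) - 1) * I + (I + (G : ℝ) * binEnt (c / G)) / (1 - 2 * c) := by
        field_simp
        ring
end

section
/- Let G ≥ 1 be a real number and let s be a real number with 0 < s ≤ 1/8. Then 2·G·h₂(2s/G) ≤ (1/(2·ln 2))·(ln G + 4/3) + 1. -/
theorem binEnt_mul_log_two (x : ℝ) :
    binEnt x * Real.log 2 = Real.negMulLog x + Real.negMulLog (1 - x) := by
  have h : Real.log 2 ≠ 0 := (Real.log_pos one_lt_two).ne'
  simp only [binEnt, Real.logb, Real.negMulLog]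
  field_simp
  ring

theorem negMulLog_le_one_sub {x : ℝ} (hx : 0 < x) : Real.negMulLog x ≤ 1 - x := by
  have h := mul_le_mul_of_nonneg_left (Real.one_sub_inv_le_log_of_pos hx) hx.le
  rw [mul_sub, mul_inv_cancel₀ hx.ne'] at h
  rw [Real.negMulLog]
  linarith

theorem two_mul_negMulLog_le_log_two {u : ℝ} (hu0 : 0 < u) (hu : u ≤ 1 / 4) :
    2 * Real.negMulLog u ≤ Real.log 2 := by
  have h := negMulLog_le_one_sub (mul_pos four_pos hu0)
  have h4 : Real.log 4 = 2 * Real.log 2 := by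
    rw [show (4 : ℝ) = 2 ^ 2 by norm_num, Real.log_pow, Nat.cast_ofNat]
  rw [Real.negMulLog, Real.log_mul four_ne_zero hu0.ne', h4] at h
  rw [Real.negMulLog]
  nlinarith [Real.log_two_gt_d9]

/-- For a real `G ≥ 1` and `0 < s ≤ 1/8`,
`2·G·h₂(2s/G) ≤ (1/(2·ln 2))·(ln G + 4/3) + 1`. -/
theorem two_G_binEnt_le (G : ℝ) (hG : 1 ≤ G) (s : ℝ) (hs0 : 0 < s) (hs : s ≤ 1 / 8) :
    2 * G * binEnt (2 * s / G)
      ≤ 1 / (2 * Real.log 2) * (Real.log G + 4 / 3) + 1 := by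
  have hG0 : 0 < G := by linarith
  have hl2 : 0 < Real.log 2 := Real.log_pos one_lt_two
  have hu0 : 0 < 2 * s := by linarith
  have hx : 2 * s / G < 1 := by rw [div_lt_one hG0]; linarith
  have hcancel : G * (2 * s / G) = 2 * s := mul_div_cancel₀ _ hG0.ne'
  have hfirst : G * Real.negMulLog (2 * s / G) =
      2 * s * Real.log G + Real.negMulLog (2 * s) := by
    rw [Real.negMulLog, Real.negMulLog, Real.log_div hu0.ne' hG0.ne']
    linear_combination (Real.log G - Real.log (2 * s)) * hcancel
  have hsecond : G * Real.negMulLog (1 - 2 * s / G) ≤ 2 * s := by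
    have h := mul_le_mul_of_nonneg_left (negMulLog_le_one_sub (sub_pos.2 hx)) hG0.le
    rwa [sub_sub_cancel, hcancel] at h
  have hrhs : (1 / (2 * Real.log 2) * (Real.log G + 4 / 3) + 1) * Real.log 2 =
      1 / 2 * (Real.log G + 4 / 3) + Real.log 2 := by
    field_simp
  refine le_of_mul_le_mul_right ?_ hl2
  rw [hrhs, mul_assoc, binEnt_mul_log_two]
  nlinarith [two_mul_negMulLog_le_log_two hu0 (by linarith), Real.log_nonneg hG]
end
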